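/- arXiv:2001.09811 — 2 statements merged into one kernel-verified Lean document; each statement's English description precedes it below -/
import Mathlib

section
/- Let A be a unital C*-algebra represented on a Hilbert space H via π, and let S be a partial isometry whose operator s := (initial corner of S) satisfies, for some f ∈ A: (1) s*π₂(f)s − π₁(f) is compact, (2) π₂(f)(ss* − 1) is compact and (s*s − 1)π₁(f) is compact, (3) [ss*, π₂(f)] and [s*s, π₁(f)] are compact. Then the unitary ŝ = [[s, (1−ss*)^{1/2}], [−(1−s*s)^{1/2}, s*]] satisfies that ŝ*(π₂(f) ⊕ 0)ŝ − (π₁(f) ⊕ 0) is compact. -/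
section CompactOperators

open ContinuousLinearMap

variable {E F : Type*} [NormedAddCommGroup E] [InnerProductSpace ℂ E] [CompleteSpace E]
  [NormedAddCommGroup F] [InnerProductSpace ℂ F] [CompleteSpace F]

/-- An operator `a` between Hilbert spaces is compact as soon as `a* a` is. -/
theorem IsCompactOperator.of_adjoint_comp_self {a : E →L[ℂ] F}
    (h : IsCompactOperator (adjoint a ∘L a)) : IsCompactOperator a := by
  have key : ∀ x : E, ‖a x‖ ^ 2 ≤ ‖(adjoint a ∘L a) x‖ * ‖x‖ := fun x ↦ by
    rw [apply_norm_sq_eq_inner_adjoint_left]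
    exact (Complex.re_le_norm _).trans (norm_inner_le_norm _ _)
  refine (isCompactOperator_iff_isCompact_closure_image_ball (𝕜₁ := ℂ) a.toLinearMap
    one_pos).2 ?_
  refine TotallyBounded.isCompact_of_isClosed (TotallyBounded.closure ?_) isClosed_closure
  rw [Metric.totallyBounded_iff]
  intro ε hε
  have htb : TotallyBounded ((adjoint a ∘L a) '' Metric.ball (0 : E) 1) :=
    (IsCompactOperator.isCompact_closure_image_ball (𝕜₁ := ℂ)
      (f := (adjoint a ∘L a).toLinearMap) h 1).totallyBounded.subset subset_closure
  obtain ⟨c, hc, hcf, hcov⟩ := Set.exists_subset_image_finite_and.1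
    (Metric.finite_approx_of_totallyBounded htb (ε ^ 2 / 2) (by positivity))
  refine ⟨a '' c, hcf.image _, ?_⟩
  rintro _ ⟨x, hx, rfl⟩
  obtain ⟨_, ⟨y, hy, rfl⟩, hxy⟩ := Set.mem_iUnion₂.1 (hcov ⟨x, hx, rfl⟩)
  refine Set.mem_iUnion₂.2 ⟨a y, ⟨y, hy, rfl⟩, ?_⟩
  have hx' : ‖x‖ < 1 := mem_ball_zero_iff.1 hx
  have hy' : ‖y‖ < 1 := mem_ball_zero_iff.1 (hc hy)
  have hn : ‖x - y‖ ≤ 2 := (norm_sub_le x y).trans (by linarith)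
  rw [mem_ball_iff_norm, ← map_sub] at hxy
  have hlt : ‖a (x - y)‖ ^ 2 < ε ^ 2 := by
    have := mul_le_mul_of_nonneg_left hn (norm_nonneg ((adjoint a ∘L a) (x - y)))
    linarith [key (x - y)]
  rw [mem_ball_iff_norm]
  change ‖a x - a y‖ < ε
  rw [← map_sub]
  exact lt_of_pow_lt_pow_left₀ 2 hε.le hlt

/-- An operator `a` between Hilbert spaces is compact as soon as `a a*` is. -/
theorem IsCompactOperator.of_self_comp_adjoint {a : E →L[ℂ] F}
    (h : IsCompactOperator (a ∘L adjoint a)) : IsCompactOperator a := by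
  have h' : IsCompactOperator (adjoint a) := of_adjoint_comp_self (by rwa [adjoint_adjoint])
  exact of_adjoint_comp_self (h'.comp_clm a)

/-- If `d` is self-adjoint and `T d²` is compact, then `T d` is compact. -/
theorem IsCompactOperator.comp_of_comp_sq {d : E →L[ℂ] E} (hd : IsSelfAdjoint d)
    {T : E →L[ℂ] F} (h : IsCompactOperator (T ∘L (d * d))) : IsCompactOperator (T ∘L d) := by
  refine of_self_comp_adjoint ?_
  rw [adjoint_comp, hd.adjoint_eq]
  exact h.comp_clm (adjoint T)

/-- If `d` is self-adjoint and `d² T` is compact, then `d T` is compact. -/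
theorem IsCompactOperator.comp_of_sq_comp {d : F →L[ℂ] F} (hd : IsSelfAdjoint d)
    {T : E →L[ℂ] F} (h : IsCompactOperator ((d * d) ∘L T)) : IsCompactOperator (d ∘L T) := by
  refine of_adjoint_comp_self ?_
  rw [adjoint_comp, hd.adjoint_eq]
  exact h.clm_comp (adjoint T)

theorem ContinuousLinearMap.one_sub_self_comp_adjoint_nonneg {s : E →L[ℂ] F} (hs : ‖s‖ ≤ 1) :
    0 ≤ (1 : F →L[ℂ] F) - s ∘L adjoint s := by
  have hs' : ‖adjoint s‖ ≤ 1 := by simpa using hs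
  rw [nonneg_iff_isPositive, isPositive_def']
  refine ⟨(IsSelfAdjoint.one _).sub (isPositive_self_comp_adjoint s).isSelfAdjoint, fun x ↦ ?_⟩
  have h1 : ‖adjoint s x‖ ^ 2 ≤ ‖x‖ ^ 2 :=
    pow_le_pow_left₀ (norm_nonneg _) ((adjoint s).le_of_opNorm_le_of_le hs' le_rfl |>.trans
      (one_mul _).le) 2
  rw [apply_norm_sq_eq_inner_adjoint_left, adjoint_adjoint] at h1
  rw [reApplyInnerSelf_apply, sub_apply, inner_sub_left, map_sub]
  change 0 ≤ RCLike.re (inner ℂ x x) - _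
  rw [inner_self_eq_norm_sq]
  exact sub_nonneg.2 h1

/-- Compression of an operator to the first summand, written with the coordinate projection. -/
theorem WithLp.eq_adjoint_fstL_comp_comp_fstL (T : E →L[ℂ] E)
    (P : WithLp 2 (E × F) →L[ℂ] WithLp 2 (E × F))
    (hP : ∀ x, WithLp.equiv 2 (E × F) (P x) = (T (WithLp.equiv 2 (E × F) x).1, 0)) :
    P = adjoint (WithLp.fstL 2 ℂ E F) ∘L T ∘L WithLp.fstL 2 ℂ E F := by
  refine ContinuousLinearMap.ext fun x ↦ ext_inner_right ℂ fun y ↦ ?_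
  have h1 : (P x).ofLp.1 = T x.ofLp.1 := congrArg Prod.fst (hP x)
  have h2 : (P x).ofLp.2 = 0 := congrArg Prod.snd (hP x)
  rw [comp_apply, adjoint_inner_left, WithLp.prod_inner_apply, h1, h2, inner_zero_left, add_zero]
  rfl

end CompactOperators

open ContinuousLinearMap in
/-- If the corner `s` of a partial isometry essentially intertwines `π₂(f)` and `π₁(f)`
(conditions (1)–(3)), then the unitary dilation
`ŝ = [[s, (1−ss*)^{1/2}], [−(1−s*s)^{1/2}, s*]]` satisfies that
`ŝ*(π₂(f) ⊕ 0)ŝ − (π₁(f) ⊕ 0)` is compact. -/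
theorem dilation_essentially_intertwines
    {A : Type*} [NormedRing A] [StarRing A] [CStarRing A] [NormedAlgebra ℂ A]
    [CompleteSpace A] [StarModule ℂ A]
    {E₁ E₂ : Type*} [NormedAddCommGroup E₁] [InnerProductSpace ℂ E₁] [CompleteSpace E₁]
    [NormedAddCommGroup E₂] [InnerProductSpace ℂ E₂] [CompleteSpace E₂]
    (π₁ : A →⋆ₐ[ℂ] (E₁ →L[ℂ] E₁)) (π₂ : A →⋆ₐ[ℂ] (E₂ →L[ℂ] E₂))
    (s : E₁ →L[ℂ] E₂) (hs : ‖s‖ ≤ 1) (f : A)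
    -- (1) `s` conjugates `π₂(f)` to `π₁(f)` modulo compacts
    (h1 : IsCompactOperator ⇑((adjoint s) ∘L π₂ f ∘L s - π₁ f))
    -- (2) defect projections are locally compact against `π(f)`
    (h2a : IsCompactOperator ⇑(π₂ f ∘L (s ∘L adjoint s - 1)))
    (h2b : IsCompactOperator ⇑(((adjoint s) ∘L s - 1) ∘L π₁ f))
    -- (3) commutators with the defect projections are compact
    (h3a : IsCompactOperator ⇑((s ∘L adjoint s) ∘L π₂ f - π₂ f ∘L (s ∘L adjoint s)))
    (h3b : IsCompactOperator ⇑(((adjoint s) ∘L s) ∘L π₁ f - π₁ f ∘L ((adjoint s) ∘L s)))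
    -- the unitary dilation `ŝ : E₁ ⊕ E₂ → E₂ ⊕ E₁`
    (shat : WithLp 2 (E₁ × E₂) →L[ℂ] WithLp 2 (E₂ × E₁))
    (hshat : ∀ x : WithLp 2 (E₁ × E₂),
      WithLp.equiv 2 (E₂ × E₁) (shat x) =
        (s (WithLp.equiv 2 (E₁ × E₂) x).1
            + CFC.sqrt ((1 : E₂ →L[ℂ] E₂) - s ∘L adjoint s) (WithLp.equiv 2 (E₁ × E₂) x).2,
         -(CFC.sqrt ((1 : E₁ →L[ℂ] E₁) - adjoint s ∘L s) (WithLp.equiv 2 (E₁ × E₂) x).1)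
            + adjoint s (WithLp.equiv 2 (E₁ × E₂) x).2))
    -- the trivially extended representations `π₂(f) ⊕ 0` and `π₁(f) ⊕ 0`
    (P₂ : WithLp 2 (E₂ × E₁) →L[ℂ] WithLp 2 (E₂ × E₁))
    (hP₂ : ∀ y : WithLp 2 (E₂ × E₁),
      WithLp.equiv 2 (E₂ × E₁) (P₂ y) = (π₂ f (WithLp.equiv 2 (E₂ × E₁) y).1, 0))
    (P₁ : WithLp 2 (E₁ × E₂) →L[ℂ] WithLp 2 (E₁ × E₂))
    (hP₁ : ∀ x : WithLp 2 (E₁ × E₂),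
      WithLp.equiv 2 (E₁ × E₂) (P₁ x) = (π₁ f (WithLp.equiv 2 (E₁ × E₂) x).1, 0)) :
    IsCompactOperator ⇑((adjoint shat) ∘L P₂ ∘L shat - P₁) := by
  set d := CFC.sqrt ((1 : E₂ →L[ℂ] E₂) - s ∘L adjoint s)
  have hd : IsSelfAdjoint d := (CFC.sqrt_nonneg _).isSelfAdjoint
  have hdd : d * d = 1 - s ∘L adjoint s :=
    CFC.sqrt_mul_sqrt_self _ (one_sub_self_comp_adjoint_nonneg hs)
  have hTd : IsCompactOperator (π₂ f ∘L d) := by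
    refine .comp_of_comp_sq hd ?_
    have : π₂ f ∘L (d * d) = -(π₂ f ∘L (s ∘L adjoint s - 1)) := by
      rw [hdd, ← comp_neg, neg_sub]
    rw [this]
    exact h2a.neg
  have hdT : IsCompactOperator (d ∘L π₂ f) := by
    refine .comp_of_sq_comp hd ?_
    have : (d * d) ∘L π₂ f = -(π₂ f ∘L (s ∘L adjoint s - 1))
        - ((s ∘L adjoint s) ∘L π₂ f - π₂ f ∘L (s ∘L adjoint s)) := by
      rw [hdd]
      ext x
      simp
    rw [this]
    exact h2a.neg.sub h3a
  set p := WithLp.fstL 2 ℂ E₁ E₂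
  set q := WithLp.sndL 2 ℂ E₁ E₂
  have hu : WithLp.fstL 2 ℂ E₂ E₁ ∘L shat = s ∘L p + d ∘L q :=
    ContinuousLinearMap.ext fun x ↦ congrArg Prod.fst (hshat x)
  have hmain : adjoint shat ∘L P₂ ∘L shat - P₁
      = adjoint p ∘L (adjoint s ∘L π₂ f ∘L s - π₁ f) ∘L p
        + adjoint p ∘L adjoint s ∘L (π₂ f ∘L d) ∘L q
        + adjoint q ∘L (d ∘L π₂ f) ∘L s ∘L p
        + adjoint q ∘L (d ∘L π₂ f) ∘L d ∘L q := by
    have hconj : adjoint shat ∘L P₂ ∘L shat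
        = adjoint (s ∘L p + d ∘L q) ∘L π₂ f ∘L (s ∘L p + d ∘L q) := by
      rw [WithLp.eq_adjoint_fstL_comp_comp_fstL (π₂ f) P₂ hP₂, ← hu, adjoint_comp]
      rfl
    rw [hconj, WithLp.eq_adjoint_fstL_comp_comp_fstL (π₁ f) P₁ hP₁, map_add, adjoint_comp,
      adjoint_comp, hd.adjoint_eq]
    ext1 x
    simp only [comp_apply, add_apply, sub_apply, map_add, map_sub]
    abel
  rw [hmain]
  exact ((((h1.comp_clm p).clm_comp (adjoint p)).add
    (((hTd.comp_clm q).clm_comp (adjoint s)).clm_comp (adjoint p))).add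
    ((hdT.comp_clm (s ∘L p)).clm_comp (adjoint q))).add
    ((hdT.comp_clm (d ∘L q)).clm_comp (adjoint q))
end

section
/- Let s be a contraction between Hilbert spaces, π₂ a representation of a C*-algebra A, f ∈ A, and ε > 0, and suppose ‖π₂(f)(ss* − 1)‖ ≤ C₁ε and ‖[ss*, π₂(f)]‖ ≤ C₂ε with both operators compact. Then (1 − ss*)^{1/2} π₂(f) is compact and its norm is bounded by √(‖f‖ (C₁ + C₂) ε). -/
/-- A bounded operator `T` into a Hilbert space is compact as soon as `T⋆T` is. -/
theorem IsCompactOperator.of_adjoint_comp_self_s10 {𝕜 E F : Type*} [RCLike 𝕜]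
    [NormedAddCommGroup E] [InnerProductSpace 𝕜 E] [CompleteSpace E]
    [NormedAddCommGroup F] [InnerProductSpace 𝕜 F] [CompleteSpace F] {T : E →L[𝕜] F}
    (hT : IsCompactOperator ⇑(ContinuousLinearMap.adjoint T ∘L T)) :
    IsCompactOperator ⇑T := by
  set S := ContinuousLinearMap.adjoint T ∘L T
  have hS : TotallyBounded (S '' Metric.ball 0 1) :=
    (IsCompactOperator.isCompact_closure_image_ball
      (f := (S : E →ₗ[𝕜] E)) hT 1).totallyBounded.subset subset_closure
  have key : ∀ x ∈ Metric.ball (0 : E) 1, ∀ y ∈ Metric.ball (0 : E) 1,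
      ‖T x - T y‖ ^ 2 ≤ 2 * ‖S x - S y‖ := by
    intro x hx y hy
    rw [mem_ball_zero_iff] at hx hy
    have hxy : ‖x - y‖ ≤ 2 := by linarith [norm_sub_le x y]
    rw [← map_sub, ← map_sub, ContinuousLinearMap.apply_norm_sq_eq_inner_adjoint_left]
    calc RCLike.re (inner 𝕜 (S (x - y)) (x - y)) ≤ ‖S (x - y)‖ * ‖x - y‖ :=
          re_inner_le_norm _ _
      _ ≤ 2 * ‖S (x - y)‖ := by nlinarith [norm_nonneg (S (x - y))]
  refine (isCompactOperator_iff_isCompact_closure_image_ball (T : E →ₗ[𝕜] F) one_pos).2 ?_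
  refine (TotallyBounded.closure ?_).isCompact_of_isClosed isClosed_closure
  rw [Metric.totallyBounded_iff]
  intro ε hε
  obtain ⟨t, ht, htf, hcov⟩ :=
    Metric.finite_approx_of_totallyBounded hS (ε ^ 2 / 2) (by positivity)
  obtain ⟨u, hu, huf, rfl⟩ := htf.exists_subset_finite_image_eq ht
  refine ⟨T '' u, huf.image _, ?_⟩
  rintro _ ⟨x, hx, rfl⟩
  have hSx := hcov (Set.mem_image_of_mem S hx)
  simp only [Set.mem_iUnion, Set.mem_image, exists_prop, exists_exists_and_eq_and] at hSx ⊢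
  obtain ⟨y, hy, hxy⟩ := hSx
  refine ⟨y, hy, ?_⟩
  rw [Metric.mem_ball, dist_eq_norm] at hxy ⊢
  exact lt_of_pow_lt_pow_left₀ 2 hε.le ((key x hx y (hu hy)).trans_lt (by linarith))

/-- The defect `1 - ss⋆` of a contraction is nonnegative. -/
theorem ContinuousLinearMap.one_sub_comp_adjoint_nonneg {𝕜 E F : Type*} [RCLike 𝕜]
    [NormedAddCommGroup E] [InnerProductSpace 𝕜 E] [CompleteSpace E]
    [NormedAddCommGroup F] [InnerProductSpace 𝕜 F] [CompleteSpace F] (s : E →L[𝕜] F)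
    (hs : ‖s‖ ≤ 1) : 0 ≤ (1 : F →L[𝕜] F) - s ∘L adjoint s := by
  rw [nonneg_iff_isPositive, isPositive_def']
  refine ⟨(IsSelfAdjoint.one _).sub (isPositive_self_comp_adjoint s).isSelfAdjoint, fun x => ?_⟩
  have hx : ‖adjoint s x‖ ≤ ‖x‖ := by
    simpa using (adjoint s).le_of_opNorm_le ((LinearIsometryEquiv.norm_map adjoint s).trans_le hs) x
  have hle : RCLike.re (inner 𝕜 (s (adjoint s x)) x) ≤ RCLike.re (inner 𝕜 x x) := by
    rw [← adjoint_inner_right, ← norm_sq_eq_re_inner, ← norm_sq_eq_re_inner]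
    gcongr
  rw [reApplyInnerSelf_apply]
  simpa [inner_sub_left] using hle

open ContinuousLinearMap in
/-- If `π₂(f)(ss* − 1)` and `[ss*, π₂(f)]` are compact of norms `≤ C₁ε`, `≤ C₂ε`, then
`(1 − ss*)^{1/2} π₂(f)` is compact of norm `≤ √(‖f‖ (C₁ + C₂) ε)`. -/
theorem sqrt_defect_norm_control
    {A : Type*} [NormedRing A] [StarRing A] [CStarRing A] [NormedAlgebra ℂ A]
    [CompleteSpace A] [StarModule ℂ A]
    {H₁ H₂ : Type*} [NormedAddCommGroup H₁] [InnerProductSpace ℂ H₁] [CompleteSpace H₁]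
    [NormedAddCommGroup H₂] [InnerProductSpace ℂ H₂] [CompleteSpace H₂]
    (s : H₁ →L[ℂ] H₂) (hs : ‖s‖ ≤ 1)
    (π₂ : A →⋆ₐ[ℂ] (H₂ →L[ℂ] H₂)) (f : A)
    (ε C₁ C₂ : ℝ) (hε : 0 < ε) (hC₁ : 0 ≤ C₁) (hC₂ : 0 ≤ C₂)
    (h1 : IsCompactOperator ⇑(π₂ f ∘L (s ∘L adjoint s - 1)))
    (h1n : ‖π₂ f ∘L (s ∘L adjoint s - 1)‖ ≤ C₁ * ε)
    (h2 : IsCompactOperator ⇑((s ∘L adjoint s) ∘L π₂ f - π₂ f ∘L (s ∘L adjoint s)))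
    (h2n : ‖(s ∘L adjoint s) ∘L π₂ f - π₂ f ∘L (s ∘L adjoint s)‖ ≤ C₂ * ε) :
    IsCompactOperator ⇑(CFC.sqrt ((1 : H₂ →L[ℂ] H₂) - s ∘L adjoint s) ∘L π₂ f) ∧
    ‖CFC.sqrt ((1 : H₂ →L[ℂ] H₂) - s ∘L adjoint s) ∘L π₂ f‖ ≤
      Real.sqrt (‖f‖ * (C₁ + C₂) * ε) := by
  set d := (1 : H₂ →L[ℂ] H₂) - s ∘L adjoint s with hd
  set T := CFC.sqrt d ∘L π₂ f with hT
  have hd0 : 0 ≤ d := one_sub_comp_adjoint_nonneg s hs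
  have hπ : ‖π₂ f‖ ≤ ‖f‖ := by
    let _ : CStarAlgebra A := {}
    exact NonUnitalStarAlgHom.norm_apply_le π₂ f
  have hsplit : d ∘L π₂ f = -(π₂ f ∘L (s ∘L adjoint s - 1)) -
      ((s ∘L adjoint s) ∘L π₂ f - π₂ f ∘L (s ∘L adjoint s)) := by
    ext x
    simp [hd]
  have hTT : adjoint T ∘L T = adjoint (π₂ f) ∘L (d ∘L π₂ f) := by
    have hsqrt : adjoint (CFC.sqrt d) = CFC.sqrt d :=
      (IsSelfAdjoint.of_nonneg (CFC.sqrt_nonneg d)).adjoint_eq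
    have hmul : CFC.sqrt d ∘L CFC.sqrt d = d := CFC.sqrt_mul_sqrt_self d hd0
    rw [hT, adjoint_comp, hsqrt, comp_assoc, ← comp_assoc (CFC.sqrt d), hmul]
  refine ⟨IsCompactOperator.of_adjoint_comp_self_s10 ?_, Real.le_sqrt_of_sq_le ?_⟩
  · rw [hTT, hsplit]
    exact (h1.neg.sub h2).clm_comp (adjoint (π₂ f))
  · calc ‖T‖ ^ 2 = ‖adjoint (π₂ f) ∘L (d ∘L π₂ f)‖ := by
          rw [← hTT, norm_adjoint_comp_self, sq]
      _ ≤ ‖adjoint (π₂ f)‖ * ‖d ∘L π₂ f‖ := opNorm_comp_le _ _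
      _ ≤ ‖f‖ * (C₁ * ε + C₂ * ε) := by
          rw [LinearIsometryEquiv.norm_map, hsplit]
          gcongr
          refine (norm_sub_le _ _).trans (add_le_add ?_ h2n)
          rwa [norm_neg]
      _ = ‖f‖ * (C₁ + C₂) * ε := by ring
end
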